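/- Let ε ∈ (0,1) and let x₁, …, xₙ ∈ ℝ^d (n ≥ 2). Then there exist a natural number m ≤ C·ε⁻²·log n (for a universal constant C), a matrix Π ∈ ℝ^{m×d}, and a map f : ℝ^d → ℝ^{m+1} such that f(xᵢ) = (Π xᵢ, 0) for every i, and for every u ∈ ℝ^d and every i, (1 − C·ε)·‖u − xᵢ‖₂ ≤ ‖f(u) − f(xᵢ)‖₂ ≤ (1 + C·ε)·‖u − xᵢ‖₂. In particular, a terminal embedding with distortion 1 + O(ε) can be chosen to act linearly (via a matrix Π, padded with a zero coordinate) on the terminal set itself. -/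

import Mathlib

/-- `(x, s) ∈ ℝ^{m+1}`: the vector whose first `m` coordinates are `x` and last is `s`. -/
noncomputable def appendCoord {m : ℕ} (x : EuclideanSpace ℝ (Fin m)) (s : ℝ) :
    EuclideanSpace ℝ (Fin (m + 1)) :=
  (EuclideanSpace.equiv (Fin (m + 1)) ℝ).symm
    (Fin.snoc (EuclideanSpace.equiv (Fin m) ℝ x) s)

open Finset

lemma sum_fin_cons {ι : Type*} [Fintype ι] {M : Type*} [AddCommMonoid M] (k : ℕ)
    (F : (Fin (k + 1) → ι) → M) :
    ∑ t, F t = ∑ i, ∑ t : Fin k → ι, F (Fin.cons i t) := by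
  rw [← Fintype.sum_prod_type' (f := fun i (t : Fin k → ι) => F (Fin.cons i t))]
  exact (Fintype.sum_equiv (Fin.consEquiv (fun _ : Fin (k + 1) => ι)) _ _ (fun p => rfl)).symm

/-- Rademacher sum. -/
noncomputable def rsum {d : ℕ} (v : Fin d → ℝ) (s : Fin d → Bool) : ℝ :=
  ∑ i, (if s i then 1 else -1) * v i

lemma rsum_cons {d : ℕ} (v : Fin (d + 1) → ℝ) (b : Bool) (s : Fin d → Bool) :
    rsum v (Fin.cons b s) = (if b then 1 else -1) * v 0 + rsum (fun i => v i.succ) s := by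
  simp [rsum, Fin.sum_univ_succ]

lemma rsum_sum_succ {d : ℕ} (v : Fin (d + 1) → ℝ) (F : ℝ → ℝ) :
    ∑ s, F (rsum v s) = ∑ s, (F (v 0 + rsum (fun i => v i.succ) s)
      + F (- v 0 + rsum (fun i => v i.succ) s)) := by
  rw [sum_fin_cons, Fintype.sum_bool, ← Finset.sum_add_distrib]
  simp [rsum_cons]

lemma rsum_one (d : ℕ) : ∑ _s : Fin d → Bool, (1 : ℝ) = 2 ^ d := by
  simp

lemma rsum_sq : ∀ {d : ℕ} (v : Fin d → ℝ), ∑ s, (rsum v s) ^ 2 = 2 ^ d * ∑ i, v i ^ 2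
  | 0, v => by simp [rsum]
  | d + 1, v => by
    rw [rsum_sum_succ v (fun x => x ^ 2)]
    have h : ∀ s, (v 0 + rsum (fun i => v i.succ) s) ^ 2 + (- v 0 + rsum (fun i => v i.succ) s) ^ 2
        = 2 * v 0 ^ 2 * 1 + 2 * (rsum (fun i => v i.succ) s) ^ 2 := fun s => by ring
    simp only [h]
    rw [Finset.sum_add_distrib, ← Finset.mul_sum, ← Finset.mul_sum, rsum_sq, rsum_one,
      Fin.sum_univ_succ]
    ring

lemma rsum_four : ∀ {d : ℕ} (v : Fin d → ℝ),
    ∑ s, (rsum v s) ^ 4 ≤ 2 ^ d * (3 * (∑ i, v i ^ 2) ^ 2)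
  | 0, v => by simp [rsum]
  | d + 1, v => by
    rw [rsum_sum_succ v (fun x => x ^ 4)]
    have h : ∀ s, (v 0 + rsum (fun i => v i.succ) s) ^ 4 + (- v 0 + rsum (fun i => v i.succ) s) ^ 4
        = 2 * v 0 ^ 4 * 1 + 12 * v 0 ^ 2 * (rsum (fun i => v i.succ) s) ^ 2
          + 2 * (rsum (fun i => v i.succ) s) ^ 4 := fun s => by ring
    simp only [h]
    rw [Finset.sum_add_distrib, Finset.sum_add_distrib, ← Finset.mul_sum, ← Finset.mul_sum,
      ← Finset.mul_sum, rsum_sq, rsum_one, Fin.sum_univ_succ]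
    have ih := rsum_four (fun i => v i.succ)
    have : (0 : ℝ) ≤ 2 ^ d * v 0 ^ 4 := by positivity
    simp only [pow_succ (2 : ℝ) d]
    nlinarith

lemma rsum_exp : ∀ {d : ℕ} (v : Fin d → ℝ) (a : ℝ),
    ∑ s, Real.exp (a * rsum v s) ≤ 2 ^ d * Real.exp (a ^ 2 * (∑ i, v i ^ 2) / 2)
  | 0, v, a => by simp [rsum]
  | d + 1, v, a => by
    rw [rsum_sum_succ v (fun x => Real.exp (a * x))]
    have h : ∀ s, Real.exp (a * (v 0 + rsum (fun i => v i.succ) s))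
        + Real.exp (a * (- v 0 + rsum (fun i => v i.succ) s))
        = 2 * Real.cosh (a * v 0) * Real.exp (a * rsum (fun i => v i.succ) s) := fun s => by
      rw [Real.cosh_eq, mul_add, mul_add, Real.exp_add, Real.exp_add, mul_neg]; ring
    simp only [h]
    rw [← Finset.mul_sum, Fin.sum_univ_succ]
    have ih := rsum_exp (fun i => v i.succ) a
    have hc := Real.cosh_le_exp_half_sq (a * v 0)
    calc _ ≤ 2 * Real.exp ((a * v 0) ^ 2 / 2) *
          (2 ^ d * Real.exp (a ^ 2 * (∑ i : Fin d, v i.succ ^ 2) / 2)) := by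
            gcongr
      _ = 2 ^ (d + 1) * (Real.exp ((a * v 0) ^ 2 / 2) *
          Real.exp (a ^ 2 * (∑ i : Fin d, v i.succ ^ 2) / 2)) := by ring
      _ = _ := by rw [← Real.exp_add]; congr 2; ring

lemma exp_neg_le_quad {x : ℝ} (hx : 0 ≤ x) : Real.exp (-x) ≤ 1 - x + x ^ 2 / 2 := by
  have h := Real.quadratic_le_exp_of_nonneg hx
  rw [Real.exp_neg, inv_le_comm₀ (Real.exp_pos _) (by nlinarith [sq_nonneg (x - 1)])]
  refine le_trans ?_ h
  rw [inv_le_iff_one_le_mul₀ (by nlinarith [sq_nonneg (x - 1)])]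
  nlinarith [pow_nonneg hx 4]

/-- Lower tail Laplace transform, one row. -/
lemma row_lower {d : ℕ} (v : Fin d → ℝ) {η : ℝ} (hη : 0 ≤ η) :
    ∑ s, Real.exp (-(η * rsum v s ^ 2)) ≤
      2 ^ d * Real.exp (-(η * ∑ i, v i ^ 2) + 3 / 2 * η ^ 2 * (∑ i, v i ^ 2) ^ 2) := by
  set R := ∑ i, v i ^ 2
  calc ∑ s, Real.exp (-(η * rsum v s ^ 2))
      ≤ ∑ s, (1 + (-η) * rsum v s ^ 2 + (η ^ 2 / 2) * rsum v s ^ 4) := by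
        refine Finset.sum_le_sum fun s _ => ?_
        refine (exp_neg_le_quad (by positivity)).trans (le_of_eq (by ring))
    _ = 2 ^ d + (-η) * (2 ^ d * R) + (η ^ 2 / 2) * ∑ s, rsum v s ^ 4 := by
        rw [Finset.sum_add_distrib, Finset.sum_add_distrib, ← Finset.mul_sum, ← Finset.mul_sum,
          rsum_sq, rsum_one]
    _ ≤ 2 ^ d + (-η) * (2 ^ d * R) + (η ^ 2 / 2) * (2 ^ d * (3 * R ^ 2)) := by
        gcongr; exact rsum_four v
    _ = 2 ^ d * ((-(η * R) + 3 / 2 * η ^ 2 * R ^ 2) + 1) := by ring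
    _ ≤ _ := by gcongr; exact Real.add_one_le_exp _

lemma gauss_shift (c : ℝ) :
    MeasureTheory.Integrable (fun x : ℝ => Real.exp (-x ^ 2 + 2 * c * x)) ∧
    ∫ x : ℝ, Real.exp (-x ^ 2 + 2 * c * x) = Real.exp (c ^ 2) * √Real.pi := by
  have h1 : (fun x : ℝ => Real.exp (-x ^ 2 + 2 * c * x))
      = fun x => Real.exp (c ^ 2) * (fun y => Real.exp (-1 * y ^ 2)) (x - c) := by
    funext x
    rw [← Real.exp_add]; congr 1; ring
  rw [h1]
  constructor
  · exact ((integrable_exp_neg_mul_sq one_pos).comp_sub_right c).const_mul _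
  · rw [MeasureTheory.integral_const_mul, MeasureTheory.integral_sub_right_eq_self
      (fun y => Real.exp (-1 * y ^ 2)), integral_gaussian]
    simp

/-- Upper tail Laplace transform, one row. -/
lemma row_upper {d : ℕ} (v : Fin d → ℝ) {η : ℝ} (hη : 0 ≤ η) (hs : η * ∑ i, v i ^ 2 ≤ 1 / 8) :
    ∑ s, Real.exp (η * rsum v s ^ 2) ≤
      2 ^ d * Real.exp (η * ∑ i, v i ^ 2 + 2 * η ^ 2 * (∑ i, v i ^ 2) ^ 2) := by
  set R := ∑ i, v i ^ 2
  have hR : 0 ≤ R := Finset.sum_nonneg fun i _ => sq_nonneg _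
  have hpi : 0 < √Real.pi := Real.sqrt_pos.2 Real.pi_pos
  have hb : 0 < 1 - 2 * η * R := by nlinarith
  have key : (∑ s, Real.exp (η * rsum v s ^ 2)) * √Real.pi ≤
      2 ^ d * √(Real.pi / (1 - 2 * η * R)) := by
    have e1 : (∑ s, Real.exp (η * rsum v s ^ 2)) * √Real.pi
        = ∫ x : ℝ, ∑ s, Real.exp (-x ^ 2 + 2 * (√η * rsum v s) * x) := by
      rw [MeasureTheory.integral_finsetSum _ (fun s _ => (gauss_shift _).1), Finset.sum_mul]
      refine Finset.sum_congr rfl fun s _ => ?_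
      rw [(gauss_shift _).2, mul_pow, Real.sq_sqrt hη]
    rw [e1, ← integral_gaussian, ← MeasureTheory.integral_const_mul]
    refine MeasureTheory.integral_mono
      (MeasureTheory.integrable_finsetSum _ (fun s _ => (gauss_shift _).1))
      ((integrable_exp_neg_mul_sq hb).const_mul _) (fun x => ?_)
    have := rsum_exp v (2 * √η * x)
    calc ∑ s, Real.exp (-x ^ 2 + 2 * (√η * rsum v s) * x)
        = Real.exp (-x ^ 2) * ∑ s, Real.exp (2 * √η * x * rsum v s) := by
          rw [Finset.mul_sum]
          refine Finset.sum_congr rfl fun s _ => ?_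
          rw [← Real.exp_add]; congr 1; ring
      _ ≤ Real.exp (-x ^ 2) * (2 ^ d * Real.exp ((2 * √η * x) ^ 2 * R / 2)) := by gcongr
      _ = 2 ^ d * (Real.exp (-x ^ 2) * Real.exp ((2 * √η * x) ^ 2 * R / 2)) := by ring
      _ = _ := by
        rw [← Real.exp_add, mul_pow, mul_pow, Real.sq_sqrt hη]; congr 2; ring
  rw [div_eq_mul_inv, Real.sqrt_mul Real.pi_pos.le] at key
  have key2 : ∑ s, Real.exp (η * rsum v s ^ 2) ≤ 2 ^ d * √((1 - 2 * η * R)⁻¹) := by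
    have : (∑ s, Real.exp (η * rsum v s ^ 2)) * √Real.pi ≤
      (2 ^ d * √((1 - 2 * η * R)⁻¹)) * √Real.pi := by linarith
    exact le_of_mul_le_mul_right this hpi
  refine key2.trans ?_
  gcongr
  rw [Real.sqrt_le_left (Real.exp_pos _).le, ← Real.exp_nat_mul, inv_le_comm₀ hb (Real.exp_pos _),
    ← Real.exp_neg]
  set y := η * R with hy
  have hy0 : 0 ≤ y := by positivity
  have e : -(((2 : ℕ) : ℝ) * (y + 2 * η ^ 2 * R ^ 2)) = -(2 * y + 4 * y ^ 2) := by
    rw [hy]; push_cast; ring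
  rw [e]
  have e2 : 1 - 2 * η * R = 1 - 2 * y := by rw [hy]; ring
  rw [e2]
  refine (exp_neg_le_quad (by positivity)).trans ?_
  nlinarith [mul_nonneg hy0 hy0, mul_nonneg (mul_nonneg hy0 hy0) (sub_nonneg.2 hs), mul_nonneg (mul_nonneg (mul_nonneg hy0 hy0) hy0) (sub_nonneg.2 hs)]

/-- Squared norm of the sign matrix applied to `v`. -/
noncomputable def qf {d m : ℕ} (v : Fin d → ℝ) (S : Fin m → Fin d → Bool) : ℝ :=
  ∑ j, rsum v (S j) ^ 2

lemma mat_lower {d : ℕ} (m : ℕ) (v : Fin d → ℝ) {η : ℝ} (hη : 0 ≤ η) :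
    ∑ S : Fin m → Fin d → Bool, Real.exp (η * (m * (∑ i, v i ^ 2) - qf v S)
      - 3 / 2 * η ^ 2 * m * (∑ i, v i ^ 2) ^ 2) ≤ (2 ^ d) ^ m := by
  set R := ∑ i, v i ^ 2 with hR
  have h1 : ∀ S : Fin m → Fin d → Bool, Real.exp (η * (m * R - qf v S)
      - 3 / 2 * η ^ 2 * m * R ^ 2) = Real.exp (m * (η * R - 3 / 2 * η ^ 2 * R ^ 2)) *
        ∏ j, Real.exp (-(η * rsum v (S j) ^ 2)) := by
    intro S
    rw [← Real.exp_sum, ← Real.exp_add, qf]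
    congr 1
    rw [Finset.sum_neg_distrib, ← Finset.mul_sum]
    ring
  simp only [h1]
  rw [← Finset.mul_sum, ← Fintype.sum_pow (fun s => Real.exp (-(η * rsum v s ^ 2)))]
  have h2 := row_lower v hη
  rw [← hR] at h2
  calc _ ≤ Real.exp (m * (η * R - 3 / 2 * η ^ 2 * R ^ 2)) *
        (2 ^ d * Real.exp (-(η * R) + 3 / 2 * η ^ 2 * R ^ 2)) ^ m := by
          gcongr
    _ = (2 ^ d) ^ m * (Real.exp (m * (η * R - 3 / 2 * η ^ 2 * R ^ 2)) *
        Real.exp (m * (-(η * R) + 3 / 2 * η ^ 2 * R ^ 2))) := by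
          rw [mul_pow, Real.exp_nat_mul (-(η * R) + 3 / 2 * η ^ 2 * R ^ 2)]; ring
    _ = (2 ^ d) ^ m := by
          rw [← Real.exp_add]; ring_nf; simp
    _ ≤ _ := le_rfl

lemma mat_upper {d : ℕ} (m : ℕ) (v : Fin d → ℝ) {η : ℝ} (hη : 0 ≤ η)
    (hs : η * ∑ i, v i ^ 2 ≤ 1 / 8) :
    ∑ S : Fin m → Fin d → Bool, Real.exp (η * (qf v S - m * (∑ i, v i ^ 2))
      - 2 * η ^ 2 * m * (∑ i, v i ^ 2) ^ 2) ≤ (2 ^ d) ^ m := by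
  have h2 := row_upper v hη hs
  set R := ∑ i, v i ^ 2 with hR
  have h1 : ∀ S : Fin m → Fin d → Bool, Real.exp (η * (qf v S - m * R)
      - 2 * η ^ 2 * m * R ^ 2) = Real.exp (-(m * (η * R + 2 * η ^ 2 * R ^ 2))) *
        ∏ j, Real.exp (η * rsum v (S j) ^ 2) := by
    intro S
    rw [← Real.exp_sum, ← Real.exp_add, qf]
    congr 1
    rw [← Finset.mul_sum]
    ring
  simp only [h1]
  rw [← Finset.mul_sum, ← Fintype.sum_pow (fun s => Real.exp (η * rsum v s ^ 2))]
  calc _ ≤ Real.exp (-(m * (η * R + 2 * η ^ 2 * R ^ 2))) *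
        (2 ^ d * Real.exp (η * R + 2 * η ^ 2 * R ^ 2)) ^ m := by
          gcongr
    _ = (2 ^ d) ^ m * (Real.exp (-(m * (η * R + 2 * η ^ 2 * R ^ 2))) *
        Real.exp (m * (η * R + 2 * η ^ 2 * R ^ 2))) := by
          rw [mul_pow, Real.exp_nat_mul (η * R + 2 * η ^ 2 * R ^ 2)]; ring
    _ = (2 ^ d) ^ m := by
          rw [← Real.exp_add]; ring_nf; simp
    _ ≤ _ := le_rfl

/-- Union bound with exponential moments. -/
lemma union_exp {J Ω : Type*} [Fintype J] [Fintype Ω] [Nonempty Ω] (F : J → Ω → ℝ) (a : J → ℝ)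
    (hF : ∀ j, ∑ ω, Real.exp (F j ω) ≤ Fintype.card Ω)
    (ha : ∑ j, Real.exp (-a j) ≤ 1) : ∃ ω, ∀ j, F j ω ≤ a j := by
  have h : ∑ ω : Ω, ∑ j, Real.exp (-a j) * Real.exp (F j ω) ≤ ∑ ω : Ω, (1 : ℝ) := by
    rw [Finset.sum_comm]
    simp only [← Finset.mul_sum]
    calc _ ≤ ∑ j, Real.exp (-a j) * (Fintype.card Ω : ℝ) := by
          gcongr with j; exact hF j
      _ = (∑ j, Real.exp (-a j)) * (Fintype.card Ω : ℝ) := by rw [Finset.sum_mul]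
      _ ≤ 1 * (Fintype.card Ω : ℝ) := by gcongr
      _ = _ := by simp
  obtain ⟨ω, -, hω⟩ := Finset.exists_le_of_sum_le Finset.univ_nonempty h
  refine ⟨ω, fun j => ?_⟩
  have h1 := (Finset.single_le_sum (f := fun j => Real.exp (-a j) * Real.exp (F j ω))
    (fun i _ => by positivity) (Finset.mem_univ j)).trans hω
  rw [← Real.exp_add, Real.exp_le_one_iff] at h1
  linarith

lemma jl_signs {d m K : ℕ} {ι : Type*} [Fintype ι] (v : ι → Fin d → ℝ)
    (hv : ∀ i, ∑ c, v i c ^ 2 ≤ 1) {ε L : ℝ} (hε : 0 < ε) (hε1 : ε < 1)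
    (hL : L ≤ m * ε ^ 2) (hW : 4 * (Fintype.card ι : ℝ) ≤ Real.exp L) :
    ∃ S : Fin m → Fin d → Bool,
      (∀ k, 1 ≤ k → k ≤ K → ∀ t : Fin k → ι,
        (1 - 5 / 2 * ε * √k) * (m * ∑ c, (∑ l, v (t l) c) ^ 2) ≤ qf (fun c => ∑ l, v (t l) c) S) ∧
      ∀ i, qf (v i) S ≤ m * (∑ c, v i c ^ 2 + 9 * ε) := by
  classical
  set z : (k : ℕ) → (Fin k → ι) → Fin d → ℝ := fun k t c => ∑ l, v (t l) c with hz
  set R : (k : ℕ) → (Fin k → ι) → ℝ := fun k t => ∑ c, z k t c ^ 2 with hRdef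
  have hR0 : ∀ k t, 0 ≤ R k t := fun k t => Finset.sum_nonneg fun _ _ => sq_nonneg _
  set η : (k : ℕ) → (Fin k → ι) → ℝ := fun k t => ε * √k / R k t with hη
  have hη0 : ∀ k t, 0 ≤ η k t := fun k t => div_nonneg (by positivity) (hR0 k t)
  let F : ((Σ k : Fin K, (Fin (k + 1) → ι)) ⊕ ι) → (Fin m → Fin d → Bool) → ℝ := fun j S =>
    match j with
    | Sum.inl ⟨k, t⟩ => η (k + 1) t * (m * R (k + 1) t - qf (z (k + 1) t) S)
        - 3 / 2 * (η (k + 1) t) ^ 2 * m * (R (k + 1) t) ^ 2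
    | Sum.inr i => (ε / 8) * (qf (v i) S - m * (∑ c, v i c ^ 2))
        - 2 * (ε / 8) ^ 2 * m * (∑ c, v i c ^ 2) ^ 2
  let a : ((Σ k : Fin K, (Fin (k + 1) → ι)) ⊕ ι) → ℝ := fun j =>
    match j with
    | Sum.inl ⟨k, t⟩ => ((k + 1 : ℕ) : ℝ) * L
    | Sum.inr i => L
  have hcard : ((Fintype.card (Fin m → Fin d → Bool) : ℕ) : ℝ) = (2 ^ d) ^ m := by
    simp
  set N : ℝ := (Fintype.card ι : ℝ) with hN
  have hx : N * Real.exp (-L) ≤ 1 / 4 := by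
    rw [Real.exp_neg, ← div_eq_mul_inv, div_le_iff₀ (Real.exp_pos _)]; linarith
  have hx0 : 0 ≤ N * Real.exp (-L) := by positivity
  obtain ⟨S, hS⟩ := union_exp F a (by
    intro j
    rw [hcard]
    match j with
    | Sum.inl ⟨k, t⟩ => exact mat_lower m (z (k + 1) t) (hη0 _ t)
    | Sum.inr i => exact mat_upper m (v i) (by positivity) (by nlinarith [hv i])) (by
    rw [Fintype.sum_sum_type, Fintype.sum_sigma]
    have e1 : ∀ k : Fin K, ∑ t : Fin (k + 1) → ι, Real.exp (-a (Sum.inl ⟨k, t⟩))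
        = (N * Real.exp (-L)) ^ ((k : ℕ) + 1) := by
      intro k
      simp only [a]
      rw [Finset.sum_const, ← mul_neg, Real.exp_nat_mul, mul_pow, nsmul_eq_mul]
      simp [hN]
    simp only [e1]
    have e2 : ∑ i : ι, Real.exp (-a (Sum.inr i)) = N * Real.exp (-L) := by
      simp [a, hN]
    rw [e2]
    have e3 : ∑ k : Fin K, (N * Real.exp (-L)) ^ ((k : ℕ) + 1) ≤ 1 / 3 := by
      calc _ ≤ ∑ k : Fin K, (1 / 4 : ℝ) ^ ((k : ℕ) + 1) := by gcongr
        _ = ∑ k ∈ Finset.range K, (1 / 4 : ℝ) ^ (k + 1) :=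
            Fin.sum_univ_eq_sum_range (fun k => (1 / 4 : ℝ) ^ (k + 1)) K
        _ = (1 - (1 / 4 : ℝ) ^ K) / 3 := by
            clear * -
            induction K with
            | zero => simp
            | succ n ih => rw [Finset.sum_range_succ, ih]; ring
        _ ≤ 1 / 3 := by
            have : (0 : ℝ) ≤ (1 / 4 : ℝ) ^ K := by positivity
            linarith
    linarith)
  refine ⟨S, ?_, ?_⟩
  · intro k hk1 hkK t
    obtain ⟨k, rfl⟩ : ∃ k', k = k' + 1 := ⟨k - 1, by omega⟩
    have h := hS (Sum.inl ⟨⟨k, by omega⟩, t⟩)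
    simp only [F, a] at h
    change (1 - 5 / 2 * ε * √((k + 1 : ℕ) : ℝ)) * (m * R (k + 1) t) ≤ qf (z (k + 1) t) S
    have hq0 : 0 ≤ qf (z (k + 1) t) S := Finset.sum_nonneg fun _ _ => sq_nonneg _
    rcases (hR0 (k + 1) t).eq_or_lt with h0 | hpos
    · rw [← h0]; simpa using hq0
    have hκ : (0 : ℝ) < ((k + 1 : ℕ) : ℝ) := by positivity
    set κ : ℝ := ((k + 1 : ℕ) : ℝ) with hκd
    have hb : 0 < ε * √κ := by positivity
    have hηR : η (k + 1) t * R (k + 1) t = ε * √κ := by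
      simp only [hη]; exact div_mul_cancel₀ _ hpos.ne'
    set r := R (k + 1) t
    set q := qf (z (k + 1) t) S
    set e := η (k + 1) t
    have hbb : (ε * √κ) ^ 2 = ε ^ 2 * κ := by rw [mul_pow, Real.sq_sqrt hκ.le]
    have hL' : κ * L ≤ m * (ε * √κ) ^ 2 := by
      rw [hbb]; nlinarith
    set b := ε * √κ
    have h3 : e * (m * r - q) ≤ 5 / 2 * b * m * b := by
      have : e ^ 2 * m * r ^ 2 = b ^ 2 * m := by rw [← hηR]; ring
      nlinarith
    have h4 : b * (m * r - q) ≤ b * (5 / 2 * b * m * r) := by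
      calc b * (m * r - q) = r * (e * (m * r - q)) := by rw [← hηR]; ring
        _ ≤ r * (5 / 2 * b * m * b) := by gcongr
        _ = _ := by ring
    have h5 := le_of_mul_le_mul_left h4 hb
    have : 5 / 2 * ε * √κ = 5 / 2 * b := by ring
    rw [this]
    linarith
  · intro i
    have h := hS (Sum.inr i)
    simp only [F, a] at h
    have h1 := hv i
    have h0 : 0 ≤ ∑ c, v i c ^ 2 := Finset.sum_nonneg fun _ _ => sq_nonneg _
    set r := ∑ c, v i c ^ 2
    have hr2 : r ^ 2 ≤ 1 := by nlinarith
    have hm : (0 : ℝ) ≤ m := by positivity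
    have h2 : (ε / 8) * (qf (v i) S - m * r) ≤ (ε / 8) * (m * (9 * ε)) := by
      have : 2 * (ε / 8) ^ 2 * m * r ^ 2 ≤ 2 * (ε / 8) ^ 2 * m * 1 := by gcongr
      have h9 : 0 ≤ m * ε ^ 2 := by positivity
      nlinarith
    have h5 := le_of_mul_le_mul_left h2 (by positivity)
    linarith

noncomputable abbrev toE {d m : ℕ} (M : Matrix (Fin m) (Fin d) ℝ) :
    EuclideanSpace ℝ (Fin d) →ₗ[ℝ] EuclideanSpace ℝ (Fin m) := Matrix.toEuclideanLin M

lemma jl_lin {d m : ℕ} (K : ℕ) {ι : Type*} [Fintype ι] (hm : 0 < m)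
    (v : ι → EuclideanSpace ℝ (Fin d))
    (hv : ∀ i, ‖v i‖ ≤ 1) {ε L : ℝ} (hε : 0 < ε) (hε1 : ε < 1)
    (hL : L ≤ m * ε ^ 2) (hW : 4 * (Fintype.card ι : ℝ) ≤ Real.exp L) :
    ∃ M : Matrix (Fin m) (Fin d) ℝ,
      (∀ k, 1 ≤ k → k ≤ K → ∀ t : Fin k → ι,
        (1 - 5 / 2 * ε * √k) * ‖∑ l, v (t l)‖ ^ 2 ≤ ‖toE M (∑ l, v (t l))‖ ^ 2) ∧
      ∀ i, ‖toE M (v i)‖ ^ 2 ≤ ‖v i‖ ^ 2 + 9 * ε := by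
  have hm' : (0 : ℝ) < m := by exact_mod_cast hm
  have hsq : ∀ i, ∑ c, v i c ^ 2 = ‖v i‖ ^ 2 := fun i => (EuclideanSpace.real_norm_sq_eq _).symm
  obtain ⟨S, h1, h2⟩ := jl_signs (m := m) (K := K) (fun i c => v i c)
    (fun i => by rw [hsq]; exact pow_le_one₀ (norm_nonneg _) (hv i)) hε hε1 hL hW
  set M : Matrix (Fin m) (Fin d) ℝ := fun j c => (if S j c then 1 else -1) / √(m : ℝ) with hM
  have hA : ∀ z : EuclideanSpace ℝ (Fin d), ‖toE M z‖ ^ 2 = qf (fun c => z c) S / m := by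
    intro z
    rw [EuclideanSpace.real_norm_sq_eq, qf, Finset.sum_div]
    refine Finset.sum_congr rfl fun j _ => ?_
    have : (toE M z) j = rsum (fun c => z c) (S j) / √(m : ℝ) := by
      change ∑ c, M j c * z c = _
      simp only [rsum, Finset.sum_div, hM]
      refine Finset.sum_congr rfl fun c _ => ?_
      ring
    rw [this, div_pow, Real.sq_sqrt hm'.le]
  refine ⟨M, fun k hk1 hk2 t => ?_, fun i => ?_⟩
  · have h := h1 k hk1 hk2 t
    have e : ∀ c, (∑ l, v (t l)) c = ∑ l, v (t l) c := fun c => by simp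
    rw [hA, le_div_iff₀ hm', EuclideanSpace.real_norm_sq_eq]
    simp only [e]
    linarith
  · have h := h2 i
    rw [hA, div_le_iff₀ hm', ← hsq]
    linarith

section moments
variable {ι : Type*} [Fintype ι] {H : Type*} [NormedAddCommGroup H] [InnerProductSpace ℝ H]

lemma mom0 (w : ι → ℝ) (hw : ∑ i, w i = 1) (k : ℕ) :
    ∑ t : Fin k → ι, ∏ l, w (t l) = 1 := by
  rw [← Fintype.sum_pow, hw, one_pow]

lemma mom1 (w : ι → ℝ) (hw : ∑ i, w i = 1) (a : ι → H) : ∀ k : ℕ,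
    ∑ t : Fin k → ι, (∏ l, w (t l)) • ∑ l, a (t l) = (k : ℝ) • ∑ i, w i • a i
  | 0 => by simp
  | k + 1 => by
    rw [sum_fin_cons]
    simp only [Fin.prod_univ_succ, Fin.sum_univ_succ, Fin.cons_zero, Fin.cons_succ, smul_add,
      Finset.sum_add_distrib, mul_smul]
    simp only [← Finset.smul_sum, mom1 w hw a k, ← Finset.sum_smul, hw]
    simp only [mom0 w hw, one_smul]
    push_cast
    rw [add_smul, one_smul, add_comm]

lemma mom2 (w : ι → ℝ) (hw : ∑ i, w i = 1) (a : ι → H) : ∀ k : ℕ,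
    ∑ t : Fin k → ι, (∏ l, w (t l)) * ‖∑ l, a (t l)‖ ^ 2
      = (k : ℝ) * (k - 1) * ‖∑ i, w i • a i‖ ^ 2 + k * ∑ i, w i * ‖a i‖ ^ 2
  | 0 => by simp
  | k + 1 => by
    set z := ∑ i, w i • a i with hz
    rw [sum_fin_cons]
    simp only [Fin.prod_univ_succ, Fin.sum_univ_succ, Fin.cons_zero, Fin.cons_succ]
    have e : ∀ i (t : Fin k → ι), w i * (∏ l, w (t l)) * ‖a i + ∑ l, a (t l)‖ ^ 2
        = w i * ‖a i‖ ^ 2 * (∏ l, w (t l))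
          + 2 * (w i * inner ℝ (a i) ((∏ l, w (t l)) • ∑ l, a (t l)))
          + w i * ((∏ l, w (t l)) * ‖∑ l, a (t l)‖ ^ 2) := by
      intro i t
      rw [norm_add_sq_real, inner_smul_right]; ring
    simp only [e, Finset.sum_add_distrib, ← Finset.mul_sum, ← inner_sum, mom0 w hw,
      mom1 w hw a k, mom2 w hw a k, ← Finset.sum_mul, hw]
    have e2 : ∑ i, w i * inner ℝ (a i) ((k : ℝ) • z) = k * ‖z‖ ^ 2 := by
      have : ∑ i, w i * inner ℝ (a i) ((k : ℝ) • z) = inner ℝ z ((k : ℝ) • z) := by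
        have h3 : inner ℝ z ((k : ℝ) • z) = inner ℝ (∑ i, w i • a i) ((k : ℝ) • z) := by rw [← hz]
        rw [h3, sum_inner]
        refine Finset.sum_congr rfl fun i _ => ?_
        rw [real_inner_smul_left]
      rw [this, inner_smul_right, real_inner_self_eq_norm_sq]
    rw [e2]
    push_cast
    ring
end moments

lemma hull_num {k ε r p P Q : ℝ} (hk2 : 2 ≤ k) (hε : 0 < ε) (hr0 : 0 < r)
    (hkl : 1 / r ^ 2 + 1 ≤ k) (hku : k * r ^ 2 ≤ 3) (hp1 : p ≤ 1)
    (hPp : P ≤ p + 9 * ε)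
    (havg : (1 - 5 / 2 * ε * √k) * (k * (k - 1) * r ^ 2 + k * p) ≤ k * (k - 1) * Q + k * P) :
    r ^ 2 - Q ≤ 38 * ε * r := by
  have hkpos : 0 < k := by linarith
  set s := √k with hs
  have hs0 : 0 < s := Real.sqrt_pos.2 hkpos
  have hss : k = s ^ 2 := (Real.sq_sqrt hkpos.le).symm
  have hsr : 1 ≤ s * r := by
    have e : 1 / r ^ 2 * r ^ 2 = 1 := by field_simp
    have : 1 ≤ (s * r) ^ 2 := by
      rw [mul_pow, ← hss]
      nlinarith [mul_le_mul_of_nonneg_right hkl (sq_nonneg r)]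
    nlinarith [mul_pos hs0 hr0]
  have hs1 : 1 ≤ s := by nlinarith
  have d1 : (k - 1) * (r ^ 2 - Q) ≤ 9 * ε + 10 * s * ε := by
    have d0 : k * ((k - 1) * (r ^ 2 - Q)) ≤
        k * (P - p + 5 / 2 * ε * s * ((k - 1) * r ^ 2 + p)) := by linear_combination havg
    have d2 := le_of_mul_le_mul_left d0 hkpos
    have d3 : (k - 1) * r ^ 2 + p ≤ 4 := by nlinarith [sq_nonneg r]
    have d4 : 5 / 2 * ε * s * ((k - 1) * r ^ 2 + p) ≤ 5 / 2 * ε * s * 4 := by gcongr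
    linarith
  by_contra hcon
  push Not at hcon
  have f1 : 0 < r ^ 2 - Q := lt_trans (by positivity) hcon
  have f2 : k / 2 * (r ^ 2 - Q) ≤ 9 * ε + 10 * s * ε :=
    le_trans (mul_le_mul_of_nonneg_right (by linarith) f1.le) d1
  have f3 : s ^ 2 / 2 * (38 * ε * r) < 9 * ε + 10 * s * ε := by
    rw [hss] at f2
    exact lt_of_lt_of_le (mul_lt_mul_of_pos_left hcon (by positivity)) f2
  have f4 : s * ε ≤ s * ε * (s * r) := le_mul_of_one_le_right (by positivity) hsr
  nlinarith

lemma hull_lower {d m K : ℕ} {ι : Type*} [Fintype ι]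
    (v : ι → EuclideanSpace ℝ (Fin d)) (hv : ∀ i, ‖v i‖ ≤ 1) {ε : ℝ} (hε : 0 < ε)
    (hK : 1 / ε ^ 2 + 2 ≤ K) (M : Matrix (Fin m) (Fin d) ℝ)
    (h1 : ∀ k, 1 ≤ k → k ≤ K → ∀ t : Fin k → ι,
        (1 - 5 / 2 * ε * √k) * ‖∑ l, v (t l)‖ ^ 2 ≤ ‖toE M (∑ l, v (t l))‖ ^ 2)
    (h2 : ∀ i, ‖toE M (v i)‖ ^ 2 ≤ ‖v i‖ ^ 2 + 9 * ε)
    (w : ι → ℝ) (hw0 : ∀ i, 0 ≤ w i) (hw : ∑ i, w i = 1) :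
    ‖∑ i, w i • v i‖ - 38 * ε ≤ ‖toE M (∑ i, w i • v i)‖ := by
  set z := ∑ i, w i • v i with hz
  set r := ‖z‖ with hr
  rcases le_or_gt r (38 * ε) with hsmall | hbig
  · exact le_trans (by linarith) (norm_nonneg _)
  have hr0 : 0 < r := by linarith
  have hr1 : r ≤ 1 := by
    calc r ≤ ∑ i, ‖w i • v i‖ := norm_sum_le _ _
      _ ≤ ∑ i, w i := by
        refine Finset.sum_le_sum fun i _ => ?_
        rw [norm_smul, Real.norm_of_nonneg (hw0 i)]
        exact mul_le_of_le_one_right (hw0 i) (hv i)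
      _ = 1 := hw
  set p := ∑ i, w i * ‖v i‖ ^ 2 with hp
  set P := ∑ i, w i * ‖toE M (v i)‖ ^ 2 with hP
  have hp0 : 0 ≤ p := Finset.sum_nonneg fun i _ => mul_nonneg (hw0 i) (sq_nonneg _)
  have hp1 : p ≤ 1 := by
    calc p ≤ ∑ i, w i := by
          refine Finset.sum_le_sum fun i _ => ?_
          exact mul_le_of_le_one_right (hw0 i) (pow_le_one₀ (norm_nonneg _) (hv i))
      _ = 1 := hw
  have hPp : P ≤ p + 9 * ε := by
    calc P ≤ ∑ i, w i * (‖v i‖ ^ 2 + 9 * ε) :=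
          Finset.sum_le_sum fun i _ => mul_le_mul_of_nonneg_left (h2 i) (hw0 i)
      _ = p + 9 * ε := by
          simp only [mul_add, Finset.sum_add_distrib, ← Finset.sum_mul, hw, one_mul, hp]
  obtain ⟨k, hk⟩ : ∃ k, k = ⌈1 / r ^ 2⌉₊ + 1 := ⟨_, rfl⟩
  have hkl : 1 / r ^ 2 + 1 ≤ (k : ℝ) := by
    rw [hk]; push_cast; linarith [Nat.le_ceil (1 / r ^ 2)]
  have hku : (k : ℝ) ≤ 1 / r ^ 2 + 2 := by
    rw [hk]; push_cast
    linarith [Nat.ceil_lt_add_one (show 0 ≤ 1 / r ^ 2 by positivity)]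
  have hinv : 1 ≤ 1 / r ^ 2 := by
    rw [le_div_iff₀ (by positivity)]; nlinarith
  have hkK : k ≤ K := by
    have : 1 / r ^ 2 ≤ 1 / ε ^ 2 := by
      apply one_div_le_one_div_of_le (by positivity)
      apply pow_le_pow_left₀ hε.le; linarith
    exact_mod_cast (by linarith : (k : ℝ) ≤ K)
  have hk1 : 1 ≤ k := by omega
  have havg : (1 - 5 / 2 * ε * √k) * ((k : ℝ) * (k - 1) * r ^ 2 + k * p)
      ≤ (k : ℝ) * (k - 1) * ‖toE M z‖ ^ 2 + k * P := by
    have m1 := mom2 w hw v k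
    have m2 := mom2 w hw (fun i => toE M (v i)) k
    have e : ∑ i, w i • toE M (v i) = toE M z := by rw [hz, map_sum]; simp
    rw [e] at m2
    rw [← hz] at m1
    rw [← m1, ← m2, Finset.mul_sum]
    refine Finset.sum_le_sum fun t _ => ?_
    have := h1 k hk1 hkK t
    rw [map_sum] at this
    have hpr : 0 ≤ ∏ l, w (t l) := Finset.prod_nonneg fun l _ => hw0 _
    calc _ = (∏ l, w (t l)) * ((1 - 5 / 2 * ε * √k) * ‖∑ l, v (t l)‖ ^ 2) := by ring
      _ ≤ _ := mul_le_mul_of_nonneg_left this hpr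
  set Q := ‖toE M z‖ ^ 2 with hQ
  have hkr : (k : ℝ) * r ^ 2 ≤ 3 := by
    have e : 1 / r ^ 2 * r ^ 2 = 1 := by field_simp
    nlinarith [mul_le_mul_of_nonneg_right hku (sq_nonneg r)]
  have hfin : r ^ 2 - Q ≤ 38 * ε * r :=
    hull_num (by linarith) hε hr0 hkl hkr hp1 hPp havg
  have : r - 38 * ε ≤ ‖toE M z‖ := by
    rw [← pow_le_pow_iff_left₀ (by linarith) (norm_nonneg _) two_ne_zero, ← hQ]
    nlinarith
  exact this

lemma ext_dual {E F κ : Type*} [NormedAddCommGroup E] [InnerProductSpace ℝ E]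
    [NormedAddCommGroup F] [InnerProductSpace ℝ F] [FiniteDimensional ℝ F] [Fintype κ]
    (v : κ → E) (A : E →ₗ[ℝ] F) {δ : ℝ} (hδ : 0 ≤ δ)
    (h : ∀ c : κ → ℝ, ‖∑ i, c i • v i‖ - δ * ∑ i, |c i| ≤ ‖A (∑ i, c i • v i)‖) (w : E) :
    ∃ u : F, ‖u‖ ≤ ‖w‖ ∧ ∀ i, |inner ℝ u (A (v i)) - inner ℝ w (v i)| ≤ δ * ‖w‖ := by
  classical
  have : ProperSpace F := FiniteDimensional.proper_real F
  by_contra hcon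
  push Not at hcon
  set ρ := ‖w‖ with hρ
  have hρ0 : 0 ≤ ρ := norm_nonneg _
  let T : F →ₗ[ℝ] (κ → ℝ) := LinearMap.pi fun i => (innerₗ F).flip (A (v i))
  have hT : ∀ u i, T u i = inner ℝ u (A (v i)) := fun u i => rfl
  have hTc : Continuous T := T.continuous_of_finiteDimensional
  set lo : κ → ℝ := fun i => inner ℝ w (v i) - δ * ρ
  set hi : κ → ℝ := fun i => inner ℝ w (v i) + δ * ρ
  have hdisj : Disjoint (T '' Metric.closedBall 0 ρ) (Set.Icc lo hi) := by
    rw [Set.disjoint_left]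
    rintro _ ⟨u, hu, rfl⟩ hmem
    obtain ⟨i, hi'⟩ := hcon u (by simpa using hu)
    have h1 := hmem.1 i
    have h2 := hmem.2 i
    simp only [hT, lo, hi] at h1 h2
    exact absurd (abs_le.2 ⟨by linarith, by linarith⟩) (not_le.2 hi')
  obtain ⟨f, s, t, hf1, hst, hf2⟩ := geometric_hahn_banach_compact_closed
    ((convex_closedBall (0 : F) ρ).linear_image T) ((isCompact_closedBall (0 : F) ρ).image hTc)
    (convex_Icc lo hi) isClosed_Icc hdisj
  set c : κ → ℝ := fun i => f (Pi.single i 1) with hc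
  have hf : ∀ y, f y = ∑ i, c i * y i := by
    intro y
    have : y = ∑ i, y i • (Pi.single i (1 : ℝ) : κ → ℝ) := by
      simpa using (pi_eq_sum_univ' y)
    conv_lhs => rw [this]
    rw [map_sum]
    refine Finset.sum_congr rfl fun i _ => ?_
    rw [map_smul, smul_eq_mul, mul_comm]
  set z := ∑ i, c i • v i with hz
  have hfT : ∀ u, f (T u) = inner ℝ u (A z) := by
    intro u
    rw [hf, hz, map_sum, inner_sum]
    refine Finset.sum_congr rfl fun i _ => ?_
    rw [map_smul, inner_smul_right, hT]
  have hP : ρ * ‖A z‖ < s := by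
    rcases eq_or_ne (A z) 0 with h0 | h0
    · have := hf1 (T 0) ⟨0, by simpa using hρ0, rfl⟩
      rw [hfT] at this
      simpa [h0] using this
    · have hn : 0 < ‖A z‖ := norm_pos_iff.2 h0
      have := hf1 (T ((ρ / ‖A z‖) • A z)) ⟨_, by
        rw [mem_closedBall_zero_iff, norm_smul, Real.norm_of_nonneg (by positivity),
          div_mul_cancel₀ _ hn.ne'], rfl⟩
      rw [hfT, real_inner_smul_left, real_inner_self_eq_norm_sq] at this
      have e : ρ / ‖A z‖ * ‖A z‖ ^ 2 = ρ * ‖A z‖ := by field_simp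
      linarith
  have hδρ : 0 ≤ δ * ρ := by positivity
  have hB := hf2 (fun i => inner ℝ w (v i) - δ * ρ * (SignType.sign (c i) : ℝ)) (by
    have : ∀ i, |(SignType.sign (c i) : ℝ)| ≤ 1 := fun i => by
      rcases lt_trichotomy (c i) 0 with h | h | h <;> simp [h]
    constructor
    · intro i
      have := (abs_le.1 (this i)).2
      simp only [lo]; nlinarith
    · intro i
      have := (abs_le.1 (this i)).1
      simp only [hi]; nlinarith)
  have hBe : f (fun i => inner ℝ w (v i) - δ * ρ * (SignType.sign (c i) : ℝ))
      = inner ℝ w z - δ * ρ * ∑ i, |c i| := by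
    rw [hf, hz, inner_sum, Finset.mul_sum, ← Finset.sum_sub_distrib]
    refine Finset.sum_congr rfl fun i _ => ?_
    rw [inner_smul_right, ← self_mul_sign (c i)]; ring
  rw [hBe] at hB
  have h1 := real_inner_le_norm w z
  have h2 := mul_le_mul_of_nonneg_left (h c) hρ0
  rw [← hz] at h2
  rw [← hρ] at h1
  nlinarith

lemma append_dist {m : ℕ} (a b : EuclideanSpace ℝ (Fin m)) (s : ℝ) :
    ‖appendCoord a s - appendCoord b 0‖ ^ 2 = ‖a - b‖ ^ 2 + s ^ 2 := by
  rw [EuclideanSpace.real_norm_sq_eq, EuclideanSpace.real_norm_sq_eq, Fin.sum_univ_castSucc]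
  simp [appendCoord]

lemma signed_hull {d m n : ℕ} (A : EuclideanSpace ℝ (Fin d) →ₗ[ℝ] EuclideanSpace ℝ (Fin m))
    (v : Fin n × Fin n → EuclideanSpace ℝ (Fin d)) (hneg : ∀ i k, v (k, i) = - v (i, k)) {δ : ℝ}
    (h : ∀ w : Fin n × Fin n → ℝ, (∀ i, 0 ≤ w i) → ∑ i, w i = 1 →
      ‖∑ i, w i • v i‖ - δ ≤ ‖A (∑ i, w i • v i)‖) (k : Fin n) (c : Fin n → ℝ) :
    ‖∑ i, c i • v (i, k)‖ - δ * ∑ i, |c i| ≤ ‖A (∑ i, c i • v (i, k))‖ := by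
  set s := ∑ i, |c i| with hs
  have hs0 : 0 ≤ s := Finset.sum_nonneg fun _ _ => abs_nonneg _
  rcases hs0.eq_or_lt with h0 | hpos
  · have hc : ∀ i, c i = 0 := fun i => by
      have := (Finset.sum_eq_zero_iff_of_nonneg (fun i _ => abs_nonneg (c i))).1 h0.symm i
        (Finset.mem_univ i)
      simpa using this
    rw [← h0]
    simp [hc]
  let w0 : Fin n × Fin n → ℝ := fun q =>
    (if q.2 = k then (|c q.1| + c q.1) / 2 else 0) + (if q.1 = k then (|c q.2| - c q.2) / 2 else 0)
  have hw0 : ∀ q, 0 ≤ w0 q := by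
    intro q
    have h1 := neg_abs_le (c q.1)
    have h2 := le_abs_self (c q.2)
    apply add_nonneg <;> split_ifs <;> linarith
  have hsum : ∑ q, w0 q = s := by
    simp only [w0, Finset.sum_add_distrib, Fintype.sum_prod_type]
    rw [Finset.sum_comm (f := fun x y => if x = k then (|c y| - c y) / 2 else 0)]
    simp only [Finset.sum_ite_eq', Finset.mem_univ, if_true]
    rw [← Finset.sum_add_distrib, hs]
    refine Finset.sum_congr rfl fun i _ => by ring
  have hvec : ∑ q, w0 q • v q = ∑ i, c i • v (i, k) := by
    simp only [w0, add_smul, Finset.sum_add_distrib, Fintype.sum_prod_type, ite_smul, zero_smul]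
    rw [Finset.sum_comm (f := fun x y => if x = k then ((|c y| - c y) / 2) • v (x, y) else 0)]
    simp only [Finset.sum_ite_eq', Finset.mem_univ, if_true]
    rw [← Finset.sum_add_distrib]
    refine Finset.sum_congr rfl fun i _ => ?_
    rw [hneg i k, smul_neg, ← sub_eq_add_neg, ← sub_smul]
    congr 1; ring
  have := h (fun q => s⁻¹ * w0 q) (fun q => mul_nonneg (inv_nonneg.2 hs0) (hw0 q))
    (by rw [← Finset.mul_sum, hsum, inv_mul_cancel₀ hpos.ne'])
  simp only [mul_smul, ← Finset.smul_sum, hvec, map_smul, norm_smul, norm_inv,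
    Real.norm_of_nonneg hs0] at this
  have h3 := mul_le_mul_of_nonneg_left this hs0
  rw [mul_sub, mul_inv_cancel_left₀ hpos.ne', mul_inv_cancel_left₀ hpos.ne'] at h3
  linarith

lemma final_num {D ρ a q p b b' U G ε : ℝ} (hε : 0 < ε) (hG0 : 0 ≤ G) (hρ0 : 0 ≤ ρ)
    (ha0 : 0 ≤ a) (hD0 : 0 ≤ D)
    (hG : G ^ 2 = U ^ 2 - 2 * (a * b) + a ^ 2 * q + (ρ ^ 2 - U ^ 2))
    (hD : D ^ 2 = ρ ^ 2 - 2 * (a * b') + a ^ 2)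
    (ha2 : a ≤ D + ρ) (hkD : ρ ≤ D) (hl : (1 - 5 / 2 * ε) * p ≤ q) (hu : q ≤ p + 9 * ε)
    (hav2 : a ^ 2 * p = a ^ 2) (hi3 : -(38 * ε * ρ) ≤ b - b') (hi4 : b - b' ≤ 38 * ε * ρ) :
    (1 - 188 * ε) * D ≤ G ∧ G ≤ (1 + 188 * ε) * D := by
  have g1 : a ^ 2 * q ≤ a ^ 2 + 9 * ε * a ^ 2 := by
    have := mul_le_mul_of_nonneg_left hu (sq_nonneg a)
    linarith
  have g2 : a ^ 2 - 5 / 2 * ε * a ^ 2 ≤ a ^ 2 * q := by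
    have := mul_le_mul_of_nonneg_left hl (sq_nonneg a)
    have e : a ^ 2 * ((1 - 5 / 2 * ε) * p) = (1 - 5 / 2 * ε) * (a ^ 2 * p) := by ring
    rw [e, hav2] at this
    linarith
  have g3 : a * (b - b') ≤ a * (38 * ε * ρ) := mul_le_mul_of_nonneg_left hi4 ha0
  have g4 : a * (-(38 * ε * ρ)) ≤ a * (b - b') := mul_le_mul_of_nonneg_left hi3 ha0
  have ha3 : a ≤ 2 * D := by linarith
  have g5 : ε * a ^ 2 ≤ 4 * (ε * D ^ 2) := by
    have h4 : a ^ 2 ≤ (2 * D) ^ 2 := pow_le_pow_left₀ ha0 ha3 2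
    have := mul_le_mul_of_nonneg_left h4 hε.le
    linarith
  have g6 : a * (38 * ε * ρ) ≤ 76 * (ε * D ^ 2) := by
    have : a * ρ ≤ 2 * D * D := mul_le_mul ha3 hkD hρ0 (by positivity)
    have := mul_le_mul_of_nonneg_left this hε.le
    linarith
  have g7 : 0 ≤ ε * D ^ 2 := by positivity
  have up : G ^ 2 ≤ (1 + 188 * ε) * D ^ 2 := by linarith
  have lw : (1 - 188 * ε) * D ^ 2 ≤ G ^ 2 := by linarith
  constructor
  · rcases le_or_gt (1 - 188 * ε) 0 with h | h
    · exact (mul_nonpos_of_nonpos_of_nonneg h hD0).trans hG0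
    · rw [← pow_le_pow_iff_left₀ (by positivity) hG0 two_ne_zero, mul_pow]
      refine le_trans ?_ lw
      gcongr
      nlinarith
  · rw [← pow_le_pow_iff_left₀ hG0 (by positivity) two_ne_zero, mul_pow]
    refine up.trans ?_
    gcongr
    nlinarith

theorem optimal_terminal_embedding :
    ∃ C : ℝ, 0 < C ∧
      ∀ (d n : ℕ) (ε : ℝ), 0 < ε → ε < 1 → 2 ≤ n →
        ∀ x : Fin n → EuclideanSpace ℝ (Fin d),
          ∃ m : ℕ, (m : ℝ) ≤ C * ε⁻¹ ^ 2 * Real.log n ∧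
            ∃ M : Matrix (Fin m) (Fin d) ℝ,
              ∃ f : EuclideanSpace ℝ (Fin d) → EuclideanSpace ℝ (Fin (m + 1)),
                (∀ i, f (x i) = appendCoord (Matrix.toEuclideanLin M (x i)) 0) ∧
                ∀ (u : EuclideanSpace ℝ (Fin d)) (i : Fin n),
                  (1 - C * ε) * ‖u - x i‖ ≤ ‖f u - f (x i)‖ ∧
                  ‖f u - f (x i)‖ ≤ (1 + C * ε) * ‖u - x i‖ := by
  refine ⟨188, by norm_num, ?_⟩
  intro d n ε hε hε1 hn x
  have hn0 : (0 : ℝ) < n := by exact_mod_cast (by omega : 0 < n)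
  have hn2 : (2 : ℝ) ≤ n := by exact_mod_cast hn
  have hlog : 1 / 2 ≤ Real.log n := by
    have := Real.log_le_log (by norm_num) hn2
    linarith [Real.log_two_gt_d9]
  have hinv : 1 ≤ ε⁻¹ ^ 2 := by
    have : 1 ≤ ε⁻¹ := (one_le_inv₀ hε).2 hε1.le
    nlinarith
  set Λ := Real.log n with hΛ
  have hX : 2 ≤ 4 * ε⁻¹ ^ 2 * Λ := by nlinarith
  obtain ⟨m, hm⟩ : ∃ m, m = ⌈4 * ε⁻¹ ^ 2 * Λ⌉₊ := ⟨_, rfl⟩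
  have hml : 4 * ε⁻¹ ^ 2 * Λ ≤ (m : ℝ) := by rw [hm]; exact Nat.le_ceil _
  have hmu : (m : ℝ) ≤ 4 * ε⁻¹ ^ 2 * Λ + 1 := by
    rw [hm]; exact (Nat.ceil_lt_add_one (by linarith)).le
  have hm0 : 0 < m := by
    have : (0 : ℝ) < m := by linarith
    exact_mod_cast this
  refine ⟨m, by nlinarith, ?_⟩
  let v : Fin n × Fin n → EuclideanSpace ℝ (Fin d) := fun q =>
    ‖x q.1 - x q.2‖⁻¹ • (x q.1 - x q.2)
  have hv : ∀ q, ‖v q‖ ≤ 1 := by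
    intro q
    simp only [v, norm_smul, norm_inv, norm_norm]
    exact inv_mul_le_one
  have hva : ∀ i k, ‖x i - x k‖ • v (i, k) = x i - x k := by
    intro i k
    simp only [v]
    rcases eq_or_ne (x i - x k) 0 with h0 | h0
    · simp [h0]
    · rw [smul_smul, mul_inv_cancel₀ (norm_ne_zero_iff.2 h0), one_smul]
  have hneg : ∀ i k, v (k, i) = - v (i, k) := by
    intro i k
    simp only [v]
    rw [norm_sub_rev, ← smul_neg, neg_sub]
  clear_value v
  obtain ⟨K, hK⟩ := exists_nat_ge (1 / ε ^ 2 + 2)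
  obtain ⟨M, h1, h2⟩ := jl_lin (m := m) K hm0 v hv hε hε1 (L := 4 * Λ) (by
    have : 4 * ε⁻¹ ^ 2 * Λ * ε ^ 2 = 4 * Λ := by field_simp
    nlinarith [mul_le_mul_of_nonneg_right hml (sq_nonneg ε)]) (by
    have : Real.exp (4 * Λ) = (n : ℝ) ^ 4 := by
      rw [show (4 : ℝ) * Λ = ((4 : ℕ) : ℝ) * Λ by norm_num, Real.exp_nat_mul, hΛ,
        Real.exp_log hn0]
    rw [this]
    simp only [Fintype.card_prod, Fintype.card_fin, Nat.cast_mul]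
    have : (4 : ℝ) ≤ n * n := by nlinarith
    nlinarith)
  have hK1 : 1 ≤ K := by
    have : (1 : ℝ) ≤ K := by
      have : 0 ≤ 1 / ε ^ 2 := by positivity
      linarith
    exact_mod_cast this
  have hlow : ∀ q, (1 - 5 / 2 * ε) * ‖v q‖ ^ 2 ≤ ‖toE M (v q)‖ ^ 2 := by
    intro q
    simpa using h1 1 le_rfl hK1 (fun _ => q)
  have hhull := hull_lower v hv hε hK M h1 h2
  have hsig := signed_hull (toE M) v hneg hhull
  have hmain : ∀ u : EuclideanSpace ℝ (Fin d), ∃ y : EuclideanSpace ℝ (Fin (m + 1)),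
      (∀ i, u = x i → y = appendCoord (toE M (x i)) 0) ∧
      ∀ i, (1 - 188 * ε) * ‖u - x i‖ ≤ ‖y - appendCoord (toE M (x i)) 0‖ ∧
        ‖y - appendCoord (toE M (x i)) 0‖ ≤ (1 + 188 * ε) * ‖u - x i‖ := by
    intro u
    have : Nonempty (Fin n) := ⟨⟨0, by omega⟩⟩
    obtain ⟨k, hk⟩ := Finite.exists_min (fun i => ‖u - x i‖)
    obtain ⟨u', hu1, hu2⟩ := ext_dual (fun i => v (i, k)) (toE M) (by positivity) (hsig k) (u - x k)
    refine ⟨appendCoord (toE M (x k) + u') √(‖u - x k‖ ^ 2 - ‖u'‖ ^ 2), ?_, ?_⟩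
    · intro i hi
      have h0 : ‖u - x k‖ = 0 := le_antisymm (by simpa [hi] using hk i) (norm_nonneg _)
      have hu0 : u' = 0 := norm_le_zero_iff.1 (h0 ▸ hu1)
      have hxk : x k = x i := by rw [← hi]; exact (sub_eq_zero.1 (norm_eq_zero.1 h0)).symm
      rw [h0, hu0, hxk]
      simp
    · intro i
      have hG := append_dist (toE M (x k) + u') (toE M (x i)) √(‖u - x k‖ ^ 2 - ‖u'‖ ^ 2)
      have hG0 := norm_nonneg (appendCoord (toE M (x k) + u') √(‖u - x k‖ ^ 2 - ‖u'‖ ^ 2)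
        - appendCoord (toE M (x i)) 0)
      generalize ‖appendCoord (toE M (x k) + u') √(‖u - x k‖ ^ 2 - ‖u'‖ ^ 2)
        - appendCoord (toE M (x i)) 0‖ = G at hG hG0 ⊢
      rw [Real.sq_sqrt (by nlinarith [norm_nonneg u'])] at hG
      have hAy : toE M (x k) + u' - toE M (x i) = u' - toE M (x i - x k) := by
        rw [map_sub]; abel
      rw [hAy, norm_sub_sq_real] at hG
      have hD : ‖u - x i‖ ^ 2 = ‖u - x k‖ ^ 2 - 2 * inner ℝ (u - x k) (x i - x k)
          + ‖x i - x k‖ ^ 2 := by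
        rw [← norm_sub_sq_real]; congr 2; abel
      have ha2 : ‖x i - x k‖ ≤ ‖u - x i‖ + ‖u - x k‖ := by
        have := norm_sub_le (u - x k) (u - x i)
        rw [sub_sub_sub_cancel_left] at this
        linarith
      have hkD : ‖u - x k‖ ≤ ‖u - x i‖ := hk i
      have hi2 := hu2 i
      have hl := hlow (i, k)
      have hu := h2 (i, k)
      have hyv := hva i k
      have hav : ‖x i - x k‖ * ‖v (i, k)‖ = ‖x i - x k‖ := by
        have := congrArg norm hyv
        rwa [norm_smul, norm_norm] at this
      have e1 : ‖toE M (x i - x k)‖ ^ 2 = ‖x i - x k‖ ^ 2 * ‖toE M (v (i, k))‖ ^ 2 := by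
        conv_lhs => rw [← hyv]
        rw [map_smul, norm_smul, norm_norm, mul_pow]
      have e2 : inner ℝ u' (toE M (x i - x k))
          = ‖x i - x k‖ * inner ℝ u' (toE M (v (i, k))) := by
        conv_lhs => rw [← hyv]
        rw [map_smul, inner_smul_right]
      have e3 : inner ℝ (u - x k) (x i - x k)
          = ‖x i - x k‖ * inner ℝ (u - x k) (v (i, k)) := by
        conv_lhs => rw [← hyv]
        rw [inner_smul_right]
      have hρ0 := norm_nonneg (u - x k)
      have ha0 := norm_nonneg (x i - x k)
      have hD0 := norm_nonneg (u - x i)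
      rw [e1, e2] at hG
      rw [e3] at hD
      have hav2 : ‖x i - x k‖ ^ 2 * ‖v (i, k)‖ ^ 2 = ‖x i - x k‖ ^ 2 := by
        rw [← mul_pow, hav]
      obtain ⟨hi3, hi4⟩ := abs_le.1 hi2
      exact final_num hε hG0 hρ0 ha0 hD0 hG hD ha2 hkD hl hu hav2 hi3 hi4
  choose f hf1 hf2 using hmain
  refine ⟨M, f, fun i => hf1 (x i) i rfl, fun u i => ?_⟩
  rw [hf1 (x i) i rfl]
  exact hf2 u i
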